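/- arXiv:0909.3507 — 3 statements merged into one kernel-verified Lean document; each statement's English description precedes it below -/
import Mathlib

section
/- Let p be a prime and t, n ∈ ℕ, and write n = m·p^r with p ∤ m. Then the order of the group RC_n(𝔽_{p^t}) of invertible circulant (n × n)-matrices over the finite field 𝔽_{p^t} is ∏_{d ∣ m} (p^{t·ord_d(p^t)} − 1)^{φ(d)/ord_d(p^t)} · p^{t·(p^r − 1)·φ(d)}, where the product runs over all positive divisors d of m. -/
open Polynomial UniqueFactorizationMonoid

theorem rc_card_units_of_basis {n : ℕ} [NeZero n] {F A : Type*} [Field F] [CommRing A] [Algebra F A]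
    [Finite A] (b : Module.Basis (Fin n) F A) (hb : ∀ i j, b i * b j = b (i + j)) :
    Nat.card {M : Matrix (Fin n) (Fin n) F // IsUnit M ∧ ∃ v, M = Matrix.circulant v} =
      Nat.card Aˣ := by
  have key : ∀ a : A, Algebra.leftMulMatrix b a = Matrix.circulant (b.repr a) := by
    intro a
    ext i j
    rw [Algebra.leftMulMatrix_eq_repr_mul, Matrix.circulant_apply]
    conv_lhs => rw [← b.sum_repr a, Finset.sum_mul]
    simp only [smul_mul_assoc, hb, map_sum, map_smul, Finsupp.coe_finsetSum, Finset.sum_apply,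
      Finsupp.smul_apply, Module.Basis.repr_self, Finsupp.single_apply, smul_eq_mul, mul_ite,
      mul_one, mul_zero]
    simp only [← eq_sub_iff_add_eq]
    simp
  have inj := Algebra.leftMulMatrix_injective b
  symm
  refine Nat.card_congr (Equiv.ofBijective
    (fun u : Aˣ => ⟨Algebra.leftMulMatrix b u, u.isUnit.map _, _, key u⟩) ⟨?_, ?_⟩)
  · intro u v h
    exact Units.ext (inj (congrArg Subtype.val h))
  · rintro ⟨M, hM, v, rfl⟩
    have h1 : Algebra.leftMulMatrix b (b.equivFun.symm v) = Matrix.circulant v := by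
      rw [key]
      congr 1
      ext i
      rw [← b.equivFun_apply, LinearEquiv.apply_symm_apply]
    have h2 : IsUnit (b.equivFun.symm v) := by
      rw [← h1] at hM
      have hinj : Function.Injective (fun x => b.equivFun.symm v * x) := by
        intro x y hxy
        apply inj
        apply hM.mul_left_cancel
        rw [← map_mul, ← map_mul]
        exact congrArg _ hxy
      obtain ⟨y, hy⟩ := Finite.surjective_of_injective hinj 1
      exact IsUnit.of_mul_eq_one y hy
    exact ⟨h2.unit, Subtype.ext h1⟩

theorem rc_card_units_surj {A B : Type*} [CommRing A] [CommRing B] [Finite A] [Finite B]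
    (f : A →+* B) (hf : Function.Surjective f) (hu : ∀ a, IsUnit (f a) → IsUnit a) :
    Nat.card Aˣ * Nat.card B = Nat.card Bˣ * Nat.card A := by
  have e1 : Nat.card A = Nat.card B * Nat.card f.toAddMonoidHom.ker := by
    rw [AddSubgroup.card_eq_card_quotient_mul_card_addSubgroup f.toAddMonoidHom.ker]
    congr 1
    exact Nat.card_congr (QuotientAddGroup.quotientKerEquivOfSurjective f.toAddMonoidHom hf).toEquiv
  let g : Aˣ →* Bˣ := Units.map f
  have hg : Function.Surjective g := by
    intro u
    obtain ⟨a, ha⟩ := hf u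
    have : IsUnit a := hu a (ha ▸ u.isUnit)
    exact ⟨this.unit, Units.ext ha⟩
  have e2 : Nat.card Aˣ = Nat.card Bˣ * Nat.card g.ker := by
    rw [Subgroup.card_eq_card_quotient_mul_card_subgroup g.ker]
    congr 1
    exact Nat.card_congr (QuotientGroup.quotientKerEquivOfSurjective g hg).toEquiv
  have e3 : Nat.card g.ker = Nat.card f.toAddMonoidHom.ker := by
    refine Nat.card_congr (Equiv.ofBijective (fun u => ⟨(u : Aˣ) - 1, ?_⟩) ⟨?_, ?_⟩)
    · have := congrArg Units.val u.2
      simp only [g, Units.coe_map, Units.val_one] at this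
      rw [AddMonoidHom.mem_ker]
      show f (_ - 1) = 0
      rw [map_sub, map_one, sub_eq_zero]
      exact this
    · intro u v h
      have := congrArg Subtype.val h
      exact Subtype.ext (Units.ext (sub_left_injective this))
    · rintro ⟨a, ha⟩
      have ha : f a = 0 := ha
      have h1 : IsUnit (1 + a) := hu _ (by simp [ha])
      refine ⟨⟨h1.unit, ?_⟩, ?_⟩
      · rw [MonoidHom.mem_ker]
        ext
        simp [g, ha]
      · apply Subtype.ext
        simp
  rw [e1, e2, e3]; ring

theorem rc_finite {F : Type*} [Field F] [Fintype F] {f : F[X]} (hf : f.Monic) :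
    Finite (F[X] ⧸ Ideal.span {f}) := by
  have : Module.Finite F (AdjoinRoot f) := hf.finite_adjoinRoot
  exact (Module.finite_of_finite F : Finite (AdjoinRoot f))

theorem rc_card {F : Type*} [Field F] [Fintype F] {f : F[X]} (hf : f.Monic) :
    Nat.card (F[X] ⧸ Ideal.span {f}) = Fintype.card F ^ f.natDegree := by
  have := rc_finite hf
  have h := (AdjoinRoot.powerBasis' hf).finrank
  have : Module.Finite F (AdjoinRoot f) := hf.finite_adjoinRoot
  have h2 := Module.natCard_eq_pow_finrank (K := F) (V := AdjoinRoot f)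
  rw [h, Nat.card_eq_fintype_card (α := F)] at h2
  exact h2

theorem rc_card_pow {F : Type*} [Field F] [Fintype F] {f : F[X]} (hf : f.Monic) (e : ℕ)
    (he : e ≠ 0) :
    Nat.card (F[X] ⧸ Ideal.span {f ^ e})ˣ =
      Nat.card (F[X] ⧸ Ideal.span {f})ˣ * Fintype.card F ^ (f.natDegree * (e - 1)) := by
  have := rc_finite hf
  have := rc_finite (hf.pow e)
  have hle : Ideal.span {f ^ e} ≤ Ideal.span {f} := by
    rw [Ideal.span_singleton_le_span_singleton]
    exact dvd_pow_self f he
  have h := rc_card_units_surj (Ideal.Quotient.factor hle) (Ideal.Quotient.factor_surjective hle) (by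
    intro a
    obtain ⟨a, rfl⟩ := Ideal.Quotient.mk_surjective a
    rw [Ideal.Quotient.factor_mk]
    rw [← Ideal.span_singleton_pow]
    exact (Ideal.Quotient.isUnit_mk_pow_iff_isUnit_mk _ he).2)
  rw [rc_card hf, rc_card (hf.pow e), hf.natDegree_pow] at h
  have hq : 0 < Fintype.card F ^ f.natDegree := pow_pos Fintype.card_pos _
  refine Nat.eq_of_mul_eq_mul_right hq (h.trans ?_)
  rw [mul_assoc, ← pow_add]
  congr 2
  obtain ⟨k, rfl⟩ := Nat.exists_eq_succ_of_ne_zero he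
  simp; ring

theorem rc_card_irred {F : Type*} [Field F] [Fintype F] {f : F[X]} (hf : f.Monic)
    (hi : Irreducible f) :
    Nat.card (F[X] ⧸ Ideal.span {f})ˣ = Fintype.card F ^ f.natDegree - 1 := by
  have := rc_finite hf
  have : (Ideal.span {f}).IsMaximal :=
    PrincipalIdealRing.isMaximal_of_irreducible hi
  let _ := Ideal.Quotient.field (Ideal.span {f})
  rw [Nat.card_units, rc_card hf]

theorem rc_card_prod {F : Type*} [Field F] [Fintype F] (s : Finset F[X])
    (hs : ∀ P ∈ s, P.Monic ∧ Irreducible P) :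
    Nat.card (F[X] ⧸ Ideal.span {∏ P ∈ s, P})ˣ =
      ∏ P ∈ s, (Fintype.card F ^ P.natDegree - 1) := by
  have hco : ∀ P Q : s, P ≠ Q → IsCoprime (P : F[X]) Q := by
    intro P Q h
    refine ((hs P P.2).2.coprime_iff_not_dvd).2 fun hd => h (Subtype.ext ?_)
    exact eq_of_monic_of_associated (hs P P.2).1 (hs Q Q.2).1
      ((hs P P.2).2.associated_of_dvd (hs Q Q.2).2 hd)
  have e := Ideal.quotientInfRingEquivPiQuotient (fun P : s => Ideal.span {(P : F[X])})
    (fun P Q h => Ideal.isCoprime_span_singleton_iff _ _ |>.2 (hco P Q h))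
  rw [Ideal.iInf_span_singleton (fun i j h => hco i j h)] at e
  rw [Finset.prod_coe_sort s (fun P => P)] at e
  rw [Nat.card_congr (Units.mapEquiv e.toMulEquiv).toEquiv,
    Nat.card_congr MulEquiv.piUnits.toEquiv, Nat.card_pi]
  rw [← Finset.prod_coe_sort s (fun P => Fintype.card F ^ P.natDegree - 1)]
  exact Finset.prod_congr rfl fun (P : s) _ => rc_card_irred (hs P P.2).1 (hs P P.2).2

theorem rc_card_sqfree {F : Type*} [Field F] [Fintype F] [DecidableEq F] (f : F[X]) (hf : f.Monic)
    (h : Squarefree f) :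
    Nat.card (F[X] ⧸ Ideal.span {f})ˣ =
      ((normalizedFactors f).map fun P => Fintype.card F ^ P.natDegree - 1).prod := by
  have hnd : (normalizedFactors f).Nodup := (squarefree_iff_nodup_normalizedFactors hf.ne_zero).1 h
  have hs : ∀ P ∈ normalizedFactors f, P.Monic ∧ Irreducible P := by
    intro P hP
    have hi := irreducible_of_normalized_factor P hP
    refine ⟨?_, hi⟩
    rw [← normalize_normalized_factor P hP]
    exact monic_normalize hi.ne_zero
  have := rc_card_prod ⟨normalizedFactors f, hnd⟩ hs
  have hp : (∏ P ∈ ⟨normalizedFactors f, hnd⟩, P) = f := by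
    have h1 := prod_normalizedFactors_eq hf.ne_zero
    rw [hf.normalize_eq_self] at h1
    simpa [Finset.prod] using h1
  rw [hp] at this
  simpa [Finset.prod] using this

theorem rc_normalizedFactors_prod {F ι : Type*} [Field F] [DecidableEq F] (s : Finset ι)
    (f : ι → F[X]) (hf : ∀ i ∈ s, f i ≠ 0) :
    normalizedFactors (∏ i ∈ s, f i) = ∑ i ∈ s, normalizedFactors (f i) := by
  classical
  induction s using Finset.induction_on with
  | empty => simp
  | insert a s ha ih =>
    rw [Finset.prod_insert ha, Finset.sum_insert ha, normalizedFactors_mul (hf _ (by simp))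
      (Finset.prod_ne_zero_iff.2 fun i hi => hf i (by simp [hi])), ih fun i hi => hf i (by simp [hi])]

theorem rc_basis {F : Type*} [Field F] [Fintype F] (n : ℕ) [NeZero n] :
    Nat.card {M : Matrix (Fin n) (Fin n) F // IsUnit M ∧ ∃ v, M = Matrix.circulant v} =
      Nat.card (F[X] ⧸ Ideal.span {(X ^ n - 1 : F[X])})ˣ := by
  have hf : (X ^ n - 1 : F[X]).Monic := monic_X_pow_sub_C 1 (NeZero.ne n)
  have hd : (X ^ n - 1 : F[X]).natDegree = n := natDegree_X_pow_sub_C (r := 1)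
  have : Finite (AdjoinRoot (X ^ n - 1 : F[X])) := rc_finite hf
  let pb := AdjoinRoot.powerBasis' hf
  have hx : (AdjoinRoot.root (X ^ n - 1 : F[X])) ^ n = 1 := by
    have := AdjoinRoot.mk_self (f := (X ^ n - 1 : F[X]))
    rw [map_sub, map_pow, AdjoinRoot.mk_X, map_one, sub_eq_zero] at this
    exact this
  let b := pb.basis.reindex (finCongr (show pb.dim = n from hd))
  have hbi : ∀ i, b i = (AdjoinRoot.root (X ^ n - 1 : F[X])) ^ (i : ℕ) := by
    intro i
    simp [b, pb]
  refine rc_card_units_of_basis (A := AdjoinRoot (X ^ n - 1 : F[X])) b fun i j => ?_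
  rw [hbi, hbi, hbi, ← pow_add, Fin.val_add]
  exact pow_eq_pow_mod _ hx

theorem order_of_regular_circulant_group_over_finite_field
    (p t n m r : ℕ) (hp : p.Prime)
    (F : Type*) [Field F] [Fintype F] (hF : Fintype.card F = p ^ t)
    (hn : n = m * p ^ r) (hm : ¬ p ∣ m) :
    Nat.card {M : Matrix (Fin n) (Fin n) F // IsUnit M ∧ ∃ v, M = Matrix.circulant v} =
      ∏ d ∈ m.divisors,
        (p ^ (t * orderOf ((p : ZMod d) ^ t)) - 1) ^ (d.totient / orderOf ((p : ZMod d) ^ t)) *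
          p ^ (t * (p ^ r - 1) * d.totient) := by
  classical
  have : Fact p.Prime := ⟨hp⟩
  have hchar : CharP F p := charP_of_card_eq_prime_pow hF
  have hm0 : m ≠ 0 := by rintro rfl; simp at hm
  have hpr : p ^ r ≠ 0 := pow_ne_zero _ hp.ne_zero
  have hn0 : NeZero n := ⟨by rw [hn]; exact mul_ne_zero hm0 hpr⟩
  have hf : (X ^ m - 1 : F[X]).Monic := monic_X_pow_sub_C 1 hm0
  have hd : (X ^ m - 1 : F[X]).natDegree = m := natDegree_X_pow_sub_C (r := 1)
  have hmF : (m : F) ≠ 0 := fun h => hm ((CharP.cast_eq_zero_iff F p m).1 h)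
  have hsq : Squarefree (X ^ m - 1 : F[X]) :=
    (separable_X_pow_sub_C (1 : F) hmF one_ne_zero).squarefree
  have hX : (X ^ n - 1 : F[X]) = (X ^ m - 1) ^ (p ^ r) := by
    rw [sub_pow_char_pow, one_pow, hn, pow_mul]
  rw [rc_basis, hX, rc_card_pow hf _ hpr, hd, Finset.prod_mul_distrib]
  congr 1
  · rw [rc_card_sqfree _ hf hsq, ← prod_cyclotomic_eq_X_pow_sub_one (Nat.pos_of_ne_zero hm0),
      rc_normalizedFactors_prod _ _ (fun i _ => cyclotomic_ne_zero i F)]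
    rw [← Multiset.coe_mapAddMonoidHom, map_sum, Multiset.prod_sum]
    refine Finset.prod_congr rfl fun d hdm => ?_
    have hdm' := Nat.dvd_of_mem_divisors hdm
    have hcop : p.Coprime d := (hp.coprime_iff_not_dvd).2 fun h => hm (h.trans hdm')
    have hord : orderOf (ZMod.unitOfCoprime _ (hcop.pow_left t)) = orderOf ((p : ZMod d) ^ t) := by
      rw [← orderOf_units]
      simp
    have hdeg : ∀ P ∈ normalizedFactors (cyclotomic d F),
        P.natDegree = orderOf ((p : ZMod d) ^ t) := fun P hP => by
      rw [natDegree_of_mem_normalizedFactors_cyclotomic hF hcop hP, hord]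
    have hcard := normalizedFactors_cyclotomic_card hF hcop
    rw [hord, Multiset.toFinset_card_of_nodup ((squarefree_iff_nodup_normalizedFactors
      (cyclotomic_ne_zero d F)).1 (hsq.squarefree_of_dvd (by
        rw [← prod_cyclotomic_eq_X_pow_sub_one (Nat.pos_of_ne_zero hm0)]
        exact Finset.dvd_prod_of_mem _ hdm)))] at hcard
    rw [Multiset.coe_mapAddMonoidHom, Multiset.map_congr rfl fun P hP => by rw [hdeg P hP],
      Multiset.map_const', Multiset.prod_replicate, hcard, hF, pow_mul]
  · rw [Finset.prod_pow_eq_pow_sum, ← Finset.mul_sum, Nat.sum_totient, hF, ← pow_mul]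
    congr 1; ring
end

section
/- Let a, n ∈ ℕ and let a = ∏_{p ∣ a} p^{t_p} be the prime factorization of a. For every prime divisor p of a define r_p, m_p ∈ ℕ by n = p^{r_p}·m_p with p ∤ m_p. Then the order of the group RC_n(ℤ/aℤ) of invertible circulant (n × n)-matrices over ℤ/aℤ is ∏_{p ∣ a} ( p^{n(t_p − 1)} · ∏_{d ∣ m_p} (p^{ord_d(p)} − 1)^{φ(d)/ord_d(p)} · p^{(p^{r_p} − 1)·φ(d)} ). -/
open Polynomial

theorem fiber_count {G H : Type*} [AddGroup G] [AddGroup H] [Finite G] [Finite H] (f : G →+ H)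
    (hf : Function.Surjective f) (s : Set H) :
    Nat.card {g // f g ∈ s} * Nat.card H = Nat.card s * Nat.card G := by
  classical
  have key : ∀ s : Set H, Nat.card {g // f g ∈ s} = Nat.card s * Nat.card f.ker := by
    intro s
    have e : {g // f g ∈ s} ≃ s × f.ker :=
      { toFun := fun g => (⟨f g, g.2⟩, ⟨g - (hf (f g)).choose, by
          simp [AddMonoidHom.mem_ker, (hf (f g)).choose_spec]⟩)
        invFun := fun x => ⟨x.2 + (hf x.1).choose, by
          have := x.2.2
          rw [AddMonoidHom.mem_ker] at this
          rw [map_add, this, (hf x.1).choose_spec, zero_add]; exact x.1.2⟩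
        left_inv := fun g => by ext; simp
        right_inv := fun x => by
          have h : f (x.2 + (hf x.1).choose) = x.1 := by
            have := x.2.2
            rw [AddMonoidHom.mem_ker] at this
            rw [map_add, this, (hf x.1).choose_spec, zero_add]
          ext
          · simpa using h
          · simp [h] }
    rw [Nat.card_congr e, Nat.card_prod]
  have h1 := key s
  have h2 := key Set.univ
  have h3 : Nat.card {g // f g ∈ (Set.univ : Set H)} = Nat.card G :=
    Nat.card_congr (Equiv.subtypeUnivEquiv (by simp))
  rw [h3, Nat.card_univ] at h2
  rw [h1, h2]; ring

theorem zmod_isUnit_iff (a : ℕ) (ha : a ≠ 0) (x : ZMod a) :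
    IsUnit x ↔ ∀ p : a.primeFactors, ZMod.castHom (Nat.dvd_of_mem_primeFactors p.2) (ZMod p) x ≠ 0 := by
  have : NeZero a := ⟨ha⟩
  obtain ⟨k, rfl⟩ := ZMod.natCast_zmod_surjective x
  rw [ZMod.isUnit_iff_coprime]
  simp only [map_natCast, ne_eq, ZMod.natCast_eq_zero_iff, Subtype.forall]
  constructor
  · intro h p hp hk
    have := Nat.Coprime.eq_one_of_dvd (Nat.Coprime.coprime_dvd_right (Nat.dvd_of_mem_primeFactors hp) h).symm hk
    exact (Nat.prime_of_mem_primeFactors hp).ne_one this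
  · intro h
    apply Nat.coprime_of_dvd
    intro q hq hqk hqa
    exact h q (Nat.mem_primeFactors.2 ⟨hq, hqa, ha⟩) hqk

theorem zmod_pi_surj (a : ℕ) (y : (p : a.primeFactors) → ZMod p) :
    ∃ x : ZMod a, ∀ p : a.primeFactors,
      ZMod.castHom (Nat.dvd_of_mem_primeFactors p.2) (ZMod p) x = y p := by
  have hne : ∀ p : a.primeFactors, NeZero (p : ℕ) := fun p =>
    ⟨(Nat.prime_of_mem_primeFactors p.2).ne_zero⟩
  choose k hk using fun p : a.primeFactors => (ZMod.natCast_zmod_surjective (y p))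
  obtain ⟨z, hz⟩ := Nat.chineseRemainderOfFinset k (fun p => (p : ℕ)) Finset.univ
    (fun p _ => (hne p).1) (by
      intro p _ q _ hpq
      exact (Nat.coprime_primes (Nat.prime_of_mem_primeFactors p.2)
        (Nat.prime_of_mem_primeFactors q.2)).2 (fun h => hpq (Subtype.ext h)))
  refine ⟨z, fun p => ?_⟩
  rw [map_natCast, ← hk p]
  exact (ZMod.natCast_eq_natCast_iff _ _ _).2 (hz p (Finset.mem_univ _))

theorem step_one (a n : ℕ) (ha : a ≠ 0) (hn : n ≠ 0) :
    Nat.card {M : Matrix (Fin n) (Fin n) (ZMod a) // IsUnit M ∧ ∃ v, M = Matrix.circulant v} =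
      ∏ p ∈ a.primeFactors,
        (p ^ (n * (a.factorization p - 1)) *
          Nat.card {v : Fin n → ZMod p // IsUnit (Matrix.circulant v)}) := by
  classical
  have : NeZero a := ⟨ha⟩
  have hne : ∀ p : a.primeFactors, NeZero (p : ℕ) := fun p =>
    ⟨(Nat.prime_of_mem_primeFactors p.2).ne_zero⟩
  have hpr : ∀ p : a.primeFactors, Fact (p : ℕ).Prime := fun p =>
    ⟨(Nat.prime_of_mem_primeFactors p.2)⟩
  let f : (Fin n → ZMod a) →+ ((p : a.primeFactors) → Fin n → ZMod p) :=
    { toFun := fun v p i => ZMod.castHom (Nat.dvd_of_mem_primeFactors p.2) (ZMod p) (v i)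
      map_zero' := by ext; simp
      map_add' := by intros; ext; exact map_add _ _ _ }
  have hf : Function.Surjective f := by
    intro y
    choose x hx using fun i : Fin n => zmod_pi_surj a (fun p => y p i)
    exact ⟨x, by ext p i; exact hx i p⟩
  let s : Set ((p : a.primeFactors) → Fin n → ZMod p) :=
    {w | ∀ p, IsUnit (Matrix.circulant (w p))}
  have hfib := fiber_count f hf s
  have hs : ∀ v, f v ∈ s ↔ IsUnit (Matrix.circulant v) := by
    intro v
    rw [Matrix.isUnit_iff_isUnit_det, zmod_isUnit_iff a ha]
    refine forall_congr' fun p => ?_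
    rw [Matrix.isUnit_iff_isUnit_det, isUnit_iff_ne_zero, RingHom.map_det]
    rfl
  have e1 : {M : Matrix (Fin n) (Fin n) (ZMod a) // IsUnit M ∧ ∃ v, M = Matrix.circulant v} ≃
      {v // f v ∈ s} := by
    symm
    refine Equiv.ofBijective (fun v => ⟨Matrix.circulant v.1, (hs _).1 v.2, v.1, rfl⟩) ⟨?_, ?_⟩
    · intro v w h
      exact Subtype.ext (Matrix.Fin.circulant_injective n (congrArg Subtype.val h))
    · rintro ⟨M, hM, v, rfl⟩
      exact ⟨⟨v, (hs v).2 hM⟩, rfl⟩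
  have e2 : Nat.card s = ∏ p ∈ a.primeFactors,
      Nat.card {v : Fin n → ZMod p // IsUnit (Matrix.circulant v)} := by
    rw [← Finset.prod_coe_sort, ← Nat.card_pi]
    refine Nat.card_congr ?_
    exact Equiv.subtypePiEquivPi (p := fun {p : a.primeFactors} (v : Fin n → ZMod p) => IsUnit (Matrix.circulant v))
  have e3 : Nat.card ((p : a.primeFactors) → Fin n → ZMod p) = ∏ p ∈ a.primeFactors, p ^ n := by
    rw [← Finset.prod_coe_sort, Nat.card_pi]
    refine Finset.prod_congr rfl fun p _ => ?_
    simp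
  have e4 : Nat.card (Fin n → ZMod a) = (∏ p ∈ a.primeFactors, p ^ (n * (a.factorization p - 1))) *
      ∏ p ∈ a.primeFactors, p ^ n := by
    have : Nat.card (Fin n → ZMod a) = a ^ n := by simp
    rw [this]
    conv_lhs => rw [← Nat.prod_factorization_pow_eq_self ha]
    rw [Finsupp.prod, Nat.support_factorization, ← Finset.prod_pow, ← Finset.prod_mul_distrib]
    refine Finset.prod_congr rfl fun p hp => ?_
    have : 0 < a.factorization p := (Nat.prime_of_mem_primeFactors hp).factorization_pos_of_dvd ha
      (Nat.dvd_of_mem_primeFactors hp)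
    rw [← pow_mul, ← pow_add]
    congr 1
    obtain ⟨k, hk⟩ := Nat.exists_eq_add_of_lt this
    rw [hk]; simp; ring
  rw [e2, e3, e4, ← mul_assoc] at hfib
  rw [Nat.card_congr e1, Finset.prod_mul_distrib]
  have hpos : 0 < ∏ p ∈ a.primeFactors, p ^ n :=
    Finset.prod_pos fun p hp => pow_pos (Nat.prime_of_mem_primeFactors hp).pos _
  have := Nat.eq_of_mul_eq_mul_right hpos hfib
  rw [this, mul_comm]

/-- units as a subtype -/
noncomputable def unitsEquivIsUnit {M : Type*} [Monoid M] : Mˣ ≃ {x : M // IsUnit x} :=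
  Equiv.ofBijective (fun u => ⟨u, u.isUnit⟩) ⟨fun u v h => Units.ext (congrArg Subtype.val h), by
    rintro ⟨_, u, rfl⟩; exact ⟨u, rfl⟩⟩

/-- number of units of `F[X]/(g)` -/
noncomputable def numUnits {F : Type*} [Field F] (g : F[X]) : ℕ :=
  Nat.card (F[X] ⧸ Ideal.span {g})ˣ

theorem numUnits_mul {F : Type*} [Field F] (g h : F[X]) (hc : IsCoprime g h) :
    numUnits (g * h) = numUnits g * numUnits h := by
  unfold numUnits
  rw [← Nat.card_prod, ← Ideal.span_singleton_mul_span_singleton]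
  refine Nat.card_congr ?_
  exact ((Units.mapEquiv (Ideal.quotientMulEquivQuotientProd _ _
    ((Ideal.isCoprime_span_singleton_iff g h).2 hc)).toMulEquiv).trans
      MulEquiv.prodUnits).toEquiv

theorem numUnits_one {F : Type*} [Field F] : numUnits (1 : F[X]) = 1 := by
  unfold numUnits
  have : Subsingleton (F[X] ⧸ Ideal.span {(1 : F[X])}) :=
    Ideal.Quotient.subsingleton_iff.2 (by simp)
  exact Nat.card_of_subsingleton 1

theorem numUnits_prod {F ι : Type*} [Field F] (s : Finset ι) (g : ι → F[X])
    (hc : (s : Set ι).Pairwise fun i j => IsCoprime (g i) (g j)) :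
    numUnits (∏ i ∈ s, g i) = ∏ i ∈ s, numUnits (g i) := by
  classical
  induction s using Finset.induction_on with
  | empty => simp [numUnits_one]
  | insert i s hi ih =>
    rw [Finset.prod_insert hi, Finset.prod_insert hi, numUnits_mul, ih]
    · exact hc.mono (by simp)
    · refine IsCoprime.prod_right fun j hj => hc (by simp) (by simp [hj]) ?_
      rintro rfl; exact hi hj

theorem card_quot {F : Type*} [Field F] [Finite F] (g : F[X]) (hg : g ≠ 0) :
    Finite (F[X] ⧸ Ideal.span {g}) ∧
    Nat.card (F[X] ⧸ Ideal.span {g}) = Nat.card F ^ g.natDegree := by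
  have : Module.Finite F (F[X] ⧸ Ideal.span {g}) := (AdjoinRoot.powerBasis hg).finite
  refine ⟨Module.finite_of_finite F, ?_⟩
  rw [Module.natCard_eq_pow_finrank (K := F), finrank_quotient_span_eq_natDegree]

theorem numUnits_irred {F : Type*} [Field F] [Finite F] (g : F[X]) (hg : Irreducible g) :
    numUnits g = Nat.card F ^ g.natDegree - 1 := by
  unfold numUnits
  have := PrincipalIdealRing.isMaximal_of_irreducible hg
  let := Ideal.Quotient.field (Ideal.span {g})
  have := (card_quot g hg.ne_zero).1
  rw [Nat.card_units, (card_quot g hg.ne_zero).2]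

theorem numUnits_assoc {F : Type*} [Field F] (g h : F[X]) (hc : Associated g h) :
    numUnits g = numUnits h := by
  unfold numUnits
  rw [Ideal.span_singleton_eq_span_singleton.2 hc]

theorem numUnits_pow {F : Type*} [Field F] [Finite F] (g : F[X]) (hg : g ≠ 0) (k : ℕ)
    (hk : k ≠ 0) :
    numUnits (g ^ k) = numUnits g * Nat.card F ^ ((k - 1) * g.natDegree) := by
  have := (card_quot g hg).1
  have := (card_quot (g ^ k) (pow_ne_zero k hg)).1
  have hle : Ideal.span {g ^ k} ≤ Ideal.span {g} := by
    rw [Ideal.span_singleton_le_span_singleton]; exact dvd_pow_self _ hk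
  let f := Ideal.Quotient.factor hle
  have hf : Function.Surjective f := Ideal.Quotient.factor_surjective hle
  have hloc : ∀ x, IsUnit (f x) ↔ IsUnit x := by
    intro x
    refine ⟨fun h => ?_, fun h => h.map f⟩
    obtain ⟨x, rfl⟩ := Ideal.Quotient.mk_surjective x
    obtain ⟨y, hy⟩ := h.exists_right_inv
    obtain ⟨y, rfl⟩ := Ideal.Quotient.mk_surjective y
    simp only [f, Ideal.Quotient.factor_mk] at hy
    rw [← map_mul, ← map_one (Ideal.Quotient.mk _), Ideal.Quotient.eq,
      Ideal.mem_span_singleton] at hy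
    have hc : IsCoprime x g := by
      obtain ⟨z, hz⟩ := hy
      exact ⟨y, -z, by linear_combination hz⟩
    obtain ⟨u, v, huv⟩ := hc.pow_right (n := k)
    refine IsUnit.of_mul_eq_one (Ideal.Quotient.mk _ u) ?_
    rw [← map_mul, ← map_one (Ideal.Quotient.mk _), Ideal.Quotient.eq,
      Ideal.mem_span_singleton]
    exact ⟨-v, by linear_combination huv⟩
  have h := fiber_count f.toAddMonoidHom hf {x | IsUnit x}
  have e1 : Nat.card {x // f.toAddMonoidHom x ∈ {x | IsUnit x}} = numUnits (g ^ k) := by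
    unfold numUnits
    refine Nat.card_congr ?_
    refine (Equiv.subtypeEquivRight ?_).trans unitsEquivIsUnit.symm
    intro x; exact hloc x
  have e2 : Nat.card {x : F[X] ⧸ Ideal.span {g} | IsUnit x} = numUnits g := by
    unfold numUnits
    exact Nat.card_congr unitsEquivIsUnit.symm
  rw [e1, e2, (card_quot g hg).2, (card_quot (g ^ k) (pow_ne_zero k hg)).2, natDegree_pow] at h
  have hpos : 0 < Nat.card F ^ g.natDegree := pow_pos Nat.card_pos _
  refine Nat.eq_of_mul_eq_mul_right hpos (h.trans ?_)
  rw [mul_assoc, ← pow_add]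
  congr 2
  obtain ⟨j, rfl⟩ := Nat.exists_eq_succ_of_ne_zero hk
  simp; ring

theorem numUnits_cyclotomic (p d : ℕ) [hp : Fact p.Prime] (hd : p.Coprime d) :
    numUnits (cyclotomic d (ZMod p)) =
      (p ^ orderOf (p : ZMod d) - 1) ^ (d.totient / orderOf (p : ZMod d)) := by
  classical
  have hK : Fintype.card (ZMod p) = p ^ 1 := by simp [ZMod.card]
  have ho : orderOf (ZMod.unitOfCoprime _ (hd.pow_left 1)) = orderOf (p : ZMod d) := by
    rw [← orderOf_units]; simp
  have hcard := normalizedFactors_cyclotomic_card (K := ZMod p) hK hd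
  have hdeg := fun P hP => natDegree_of_mem_normalizedFactors_cyclotomic (K := ZMod p) (P := P) hK hd hP
  have : NeZero (d : ZMod p) := ⟨fun h => by
    rw [ZMod.natCast_eq_zero_iff] at h
    exact (Nat.Prime.coprime_iff_not_dvd hp.out).1 hd h⟩
  have hsq := squarefree_cyclotomic d (ZMod p)
  have hnd := (UniqueFactorizationMonoid.squarefree_iff_nodup_normalizedFactors
    (cyclotomic_ne_zero d (ZMod p))).1 hsq
  have hprod := UniqueFactorizationMonoid.prod_normalizedFactors (cyclotomic_ne_zero d (ZMod p))
  set S := UniqueFactorizationMonoid.normalizedFactors (cyclotomic d (ZMod p)) with hS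
  have h2 : S.prod = ∏ P ∈ S.toFinset, P := by
    rw [Finset.prod_multiset_count]
    refine Finset.prod_congr rfl fun P hP => ?_
    rw [Multiset.count_eq_one_of_mem hnd (Multiset.mem_toFinset.1 hP), pow_one]
  rw [← numUnits_assoc _ _ hprod, h2, numUnits_prod, ← ho, ← hcard, ← Finset.prod_const]
  · refine Finset.prod_congr rfl fun P hP => ?_
    rw [Multiset.mem_toFinset] at hP
    rw [numUnits_irred P (UniqueFactorizationMonoid.irreducible_of_normalized_factor P hP),
      hdeg P hP]
    simp
  · intro P hP Q hQ hne
    have hP' := Multiset.mem_toFinset.1 hP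
    have hQ' := Multiset.mem_toFinset.1 hQ
    refine (Irreducible.coprime_iff_not_dvd
      (UniqueFactorizationMonoid.irreducible_of_normalized_factor P hP')).2 fun hdvd => hne ?_
    have := (UniqueFactorizationMonoid.irreducible_of_normalized_factor P hP').associated_of_dvd
      (UniqueFactorizationMonoid.irreducible_of_normalized_factor Q hQ') hdvd
    have h3 := UniqueFactorizationMonoid.normalize_normalized_factor P hP'
    have h4 := UniqueFactorizationMonoid.normalize_normalized_factor Q hQ'
    rw [← h3, ← h4]
    exact normalize_eq_normalize_iff_associated.2 this

theorem numUnits_X_pow_sub_one (p n : ℕ) [hp : Fact p.Prime] (hn : n ≠ 0) :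
    numUnits (X ^ n - 1 : (ZMod p)[X]) =
          ∏ d ∈ (n / p ^ n.factorization p).divisors,
            (p ^ orderOf (p : ZMod d) - 1) ^ (d.totient / orderOf (p : ZMod d)) *
              p ^ ((p ^ n.factorization p - 1) * d.totient) := by
  set m := n / p ^ n.factorization p with hm
  have hcop : p.Coprime m := Nat.coprime_ordCompl hp.out hn
  have hm0 : 0 < m := Nat.ordCompl_pos p hn
  have hnm : n = m * p ^ n.factorization p := by
    rw [mul_comm]; exact (Nat.ordProj_mul_ordCompl_eq_self n p).symm
  have h1 : (X ^ n - 1 : (ZMod p)[X]) = (X ^ m - 1) ^ p ^ n.factorization p := by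
    rw [sub_pow_char_pow, one_pow, ← pow_mul, ← hnm]
  have hne : (X ^ m - 1 : (ZMod p)[X]) ≠ 0 := (monic_X_pow_sub_C (1 : ZMod p) hm0.ne').ne_zero
  have hdeg : (X ^ m - 1 : (ZMod p)[X]).natDegree = m := natDegree_X_pow_sub_C (r := (1 : ZMod p))
  rw [h1, numUnits_pow _ hne _ (pow_ne_zero _ hp.out.ne_zero), hdeg, Finset.prod_mul_distrib,
    Finset.prod_pow_eq_pow_sum, ← Finset.mul_sum, Nat.sum_totient, Nat.card_zmod,
    ← prod_cyclotomic_eq_X_pow_sub_one hm0, numUnits_prod]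
  · congr 1
    refine Finset.prod_congr rfl fun d hd => ?_
    exact numUnits_cyclotomic p d (hcop.coprime_dvd_right (Nat.dvd_of_mem_divisors hd))
  · intro d hd e he hde
    have hsep : (X ^ m - 1 : (ZMod p)[X]).Separable := by
      rw [X_pow_sub_one_separable_iff, Ne, ZMod.natCast_eq_zero_iff]
      exact (Nat.Prime.coprime_iff_not_dvd hp.out).1 hcop
    rw [← prod_cyclotomic_eq_X_pow_sub_one hm0] at hsep
    have := Polynomial.Separable.isCoprime (f := cyclotomic d (ZMod p)) (g := cyclotomic e (ZMod p))
      (hsep.of_dvd ?_)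
    · exact this
    · rw [← Finset.mul_prod_erase _ _ hd]
      exact mul_dvd_mul_left _ (Finset.dvd_prod_of_mem _ (Finset.mem_erase.2 ⟨hde.symm, he⟩))

theorem shift_pow {F : Type*} [Field F] (n : ℕ) [NeZero n] (k : ℕ) :
    (Matrix.circulant (Pi.single (1 : Fin n) (1 : F))) ^ k =
      Matrix.circulant (Pi.single (Fin.ofNat n k) (1 : F)) := by
  induction k with
  | zero =>
    rw [pow_zero]
    exact (Matrix.circulant_single_one F (Fin n)).symm
  | succ k ih =>
    rw [pow_succ, ih, Matrix.circulant_mul]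
    congr 1
    have h : Fin.ofNat n (k + 1) = Fin.ofNat n k + 1 := by
      ext; simp [Fin.ofNat, Fin.val_add]
    ext i
    simp only [Matrix.mulVec_single_one, Matrix.col_apply, Matrix.circulant_apply,
      Pi.single_apply, h, sub_eq_iff_eq_add]

theorem aeval_shift {F : Type*} [Field F] (n : ℕ) [NeZero n] (v : Fin n → F) :
    aeval (Matrix.circulant (Pi.single (1 : Fin n) (1 : F))) (∑ i : Fin n, C (v i) * X ^ (i : ℕ)) =
      Matrix.circulant v := by
  rw [map_sum]
  ext i j
  rw [Matrix.sum_apply]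
  simp only [map_mul, aeval_C, map_pow, aeval_X, shift_pow, ← Algebra.smul_def,
    Matrix.smul_apply, Matrix.circulant_apply, Pi.single_apply, Fin.ofNat_val_eq_self]
  simp

theorem step_field (p n : ℕ) [hp : Fact p.Prime] (hn : n ≠ 0) :
    Nat.card {v : Fin n → ZMod p // IsUnit (Matrix.circulant v)} =
      numUnits (X ^ n - 1 : (ZMod p)[X]) := by
  have : NeZero n := ⟨hn⟩
  set P := Matrix.circulant (Pi.single (1 : Fin n) (1 : ZMod p)) with hP
  set g : (ZMod p)[X] := X ^ n - 1 with hg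
  have hmon : g.Monic := monic_X_pow_sub_C (1 : ZMod p) hn
  have hdeg : g.natDegree = n := natDegree_X_pow_sub_C (r := (1 : ZMod p))
  let φ : (Fin n → ZMod p) → (ZMod p)[X] := fun v => ∑ i : Fin n, C (v i) * X ^ (i : ℕ)
  have hφ : ∀ v, aeval P (φ v) = Matrix.circulant v := aeval_shift n
  have hPg : aeval P g = 0 := by
    rw [hg, map_sub, map_pow, aeval_X, map_one, hP, shift_pow, sub_eq_zero]
    have : Fin.ofNat n n = 0 := by ext; simp [Fin.ofNat]
    rw [this]
    exact Matrix.circulant_single_one _ _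
  have hrem : ∀ q : (ZMod p)[X], ∃ v, g ∣ q - φ v := by
    intro q
    refine ⟨fun i => (q %ₘ g).coeff i, ?_⟩
    have h1 : φ (fun i => (q %ₘ g).coeff i) = q %ₘ g := by
      have hlt : (q %ₘ g).natDegree < n := by
        have := natDegree_modByMonic_lt q hmon (by
          intro h; rw [h] at hdeg; simp at hdeg; exact hn hdeg.symm)
        rwa [hdeg] at this
      conv_rhs => rw [as_sum_range_C_mul_X_pow' _ hlt]
      exact (Finset.sum_range (fun i => C ((q %ₘ g).coeff i) * X ^ i)).symm
    rw [h1]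
    exact ⟨q /ₘ g, by linear_combination -(modByMonic_add_div q g)⟩
  have hdvd : ∀ q, aeval P q = 0 ↔ g ∣ q := by
    intro q
    constructor
    · intro h
      obtain ⟨v, hv⟩ := hrem q
      obtain ⟨w, hw⟩ := hv
      have h2 : aeval P (q - φ v) = 0 := by rw [hw, map_mul, hPg, zero_mul]
      rw [map_sub, h, hφ, zero_sub, neg_eq_zero, ← Matrix.circulant_zero] at h2
      have h3 : v = 0 := Matrix.Fin.circulant_injective n h2
      refine ⟨w, ?_⟩
      rw [← hw, h3]; simp [φ]
    · rintro ⟨w, rfl⟩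
      rw [map_mul, hPg, zero_mul]
  have hunit : ∀ q, IsUnit (aeval P q) ↔ IsUnit (Ideal.Quotient.mk (Ideal.span {g}) q) := by
    intro q
    have key : ∀ r, aeval P q * aeval P r = 1 ↔
        Ideal.Quotient.mk (Ideal.span {g}) q * Ideal.Quotient.mk (Ideal.span {g}) r = 1 := by
      intro r
      rw [← map_mul, ← map_mul, ← map_one (aeval (R := ZMod p) P), ← map_one (Ideal.Quotient.mk _),
        Ideal.Quotient.eq, Ideal.mem_span_singleton, ← hdvd, map_sub, sub_eq_zero]
    constructor
    · intro h
      obtain ⟨u, hu⟩ := h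
      have hfin : 0 < orderOf u := orderOf_pos u
      refine IsUnit.of_mul_eq_one (Ideal.Quotient.mk _ (q ^ (orderOf u - 1))) ((key _).1 ?_)
      rw [map_pow, ← hu, ← pow_succ', Nat.sub_add_cancel hfin, ← Units.val_pow_eq_pow_val,
        pow_orderOf_eq_one, Units.val_one]
    · intro h
      obtain ⟨r, hr⟩ := h.exists_right_inv
      obtain ⟨r, rfl⟩ := Ideal.Quotient.mk_surjective r
      exact IsUnit.of_mul_eq_one _ ((key r).2 hr)
  unfold numUnits
  refine Nat.card_congr (Equiv.trans ?_ unitsEquivIsUnit.symm)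
  refine Equiv.ofBijective (fun v => ⟨Ideal.Quotient.mk _ (φ v.1), (hunit _).1 (by
    rw [hφ]; exact v.2)⟩) ⟨?_, ?_⟩
  · intro v w h
    have h := congrArg Subtype.val h
    simp only [Ideal.Quotient.eq, Ideal.mem_span_singleton] at h
    rw [← hdvd, map_sub, hφ, hφ, sub_eq_zero] at h
    exact Subtype.ext (Matrix.Fin.circulant_injective n h)
  · rintro ⟨x, hx⟩
    obtain ⟨q, rfl⟩ := Ideal.Quotient.mk_surjective x
    obtain ⟨v, hv⟩ := hrem q
    have hv' : Ideal.Quotient.mk (Ideal.span {g}) (φ v) = Ideal.Quotient.mk (Ideal.span {g}) q := by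
      rw [eq_comm, Ideal.Quotient.eq, Ideal.mem_span_singleton]; exact hv
    refine ⟨⟨v, ?_⟩, Subtype.ext hv'⟩
    rw [← hφ, hunit, hv']; exact hx


/-- **Theorem 2**: Let `a, n ∈ ℕ` with prime factorization `a = ∏_{p ∣ a} p^{t_p}`, and for each
prime `p ∣ a` write `n = p^{r_p} · m_p` with `p ∤ m_p` (so `r_p = n.factorization p` and
`m_p = n / p^{r_p}`). Then the number of invertible circulant `n × n` matrices over `ℤ/aℤ` is
`∏_{p ∣ a} ( p^{n(t_p − 1)} ∏_{d ∣ m_p} (p^{ord_d(p)} − 1)^{φ(d)/ord_d(p)} · p^{(p^{r_p} − 1)φ(d)} )`. -/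
theorem order_of_regular_circulant_group_over_zmod
    (a n : ℕ) (ha : a ≠ 0) (hn : n ≠ 0) :
    Nat.card {M : Matrix (Fin n) (Fin n) (ZMod a) // IsUnit M ∧ ∃ v, M = Matrix.circulant v} =
      ∏ p ∈ a.primeFactors,
        (p ^ (n * (a.factorization p - 1)) *
          ∏ d ∈ (n / p ^ n.factorization p).divisors,
            (p ^ orderOf (p : ZMod d) - 1) ^ (d.totient / orderOf (p : ZMod d)) *
              p ^ ((p ^ n.factorization p - 1) * d.totient)) := by
  rw [step_one a n ha hn]
  refine Finset.prod_congr rfl fun p hp => ?_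
  have : Fact p.Prime := ⟨Nat.prime_of_mem_primeFactors hp⟩
  rw [step_field p n hn, numUnits_X_pow_sub_one p n hn]
end

section
/- Let p be a prime, t, n ∈ ℕ, write n = m·p^r with p ∤ m, and let 𝔽_{p^s} ≥ 𝔽_{p^t} be a field extension containing the m-th roots of unity. Let σ : ℤ/mℤ → ℤ/mℤ be the permutation x ↦ p^{−t}·x, written as a product σ = σ_1 ⋯ σ_l of disjoint cycles σ_k = (s_{k,1}, …, s_{k,m_k}) of length m_k. Then, as a subgroup of GL_n(𝔽_{p^s}), the group RC_n(𝔽_{p^t}) is conjugate to the group of all block-diagonal matrices diag(T(v_{(1)}), …, T(v_{(m)})) with blocks indexed by vectors v_{(i)} = (v_{i,1}, …, v_{i,p^r}) ∈ 𝔽_{p^s}^{p^r} satisfying: (a) v_{1,p^r}, v_{2,p^r}, …, v_{m,p^r} ≠ 0; (b) v_{(s_{k,1})} ∈ 𝔽_{p^{t·m_k}}^{p^r} for 1 ≤ k ≤ l; and (c) v_{(s_{k,i})} = F^{(i−1)t}(v_{(s_{k,1})}) for 2 ≤ i ≤ m_k and 1 ≤ k ≤ l. -/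
/-- For `w = (w_1, …, w_N)`, the upper triangular matrix `T(w)` with `(i, j)`-entry
`w_{N−j+i}` (`1`-based; entries with out-of-range index are `0`). Written `0`-based:
the `(i, j)`-entry is `w_{N−1−j+i}` for `i ≤ j` and `0` otherwise. -/
def triangularOf {F : Type*} [Zero F] {N : ℕ} (w : Fin N → F) : Matrix (Fin N) (Fin N) F :=
  Matrix.of fun i j =>
    if h : (i : ℕ) ≤ (j : ℕ) then
      w ⟨N - 1 - (j : ℕ) + (i : ℕ), by have := j.isLt; omega⟩
    else 0

open Polynomial in
/-- confluent Vandermonde matrix -/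
noncomputable def cvm {A F : Type*} [Field F] (n N : ℕ) (z : A → F) :
    Matrix (A × Fin N) (Fin n) F :=
  Matrix.of fun x j => ((X + C (z x.1)) ^ (j : ℕ) : F[X]).coeff (N - 1 - (x.2 : ℕ))

open Polynomial in
/-- the polynomial with coefficients `w`, expanded at `a` -/
noncomputable def expandAt {F : Type*} [Field F] {n : ℕ} (w : Fin n → F) (a : F) : F[X] :=
  ∑ i : Fin n, C (w i) * (X + C a) ^ (i : ℕ)

/-- vector of Taylor coefficients -/
noncomputable def tay {A F : Type*} [Field F] {n : ℕ} (N : ℕ) (z : A → F) (w : Fin n → F) :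
    A → Fin N → F :=
  fun b i => (expandAt w (z b)).coeff (N - 1 - (i : ℕ))

/-- block diagonal matrix -/
def blk {A F : Type*} [Field F] [DecidableEq A] {N : ℕ} (v : A → Fin N → F) :
    Matrix (A × Fin N) (A × Fin N) F :=
  Matrix.of fun x y => if x.1 = y.1 then triangularOf (v x.1) x.2 y.2 else 0

lemma cvm_mulVec {A F : Type*} [Field F] {n : ℕ} (N : ℕ) (z : A → F) (w : Fin n → F)
    (x : A × Fin N) : (cvm n N z).mulVec w x = tay N z w x.1 x.2 := by
  simp [cvm, Matrix.mulVec, dotProduct, tay, expandAt, Polynomial.finsetSum_coeff, mul_comm]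

open Polynomial in
lemma pow_mod_coeff {F : Type*} [Field F] {p r m n : ℕ} (hp : p.Prime) [CharP F p]
    (hn : n = m * p ^ r) (a : F) (ha : a ^ m = 1) (k d : ℕ) (hd : d < p ^ r) :
    ((X + C a) ^ (k % n) : F[X]).coeff d = ((X + C a) ^ k : F[X]).coeff d := by
  have := Fact.mk hp
  have h1 : (X : F[X]) ∣ (X + C a) ^ m - 1 := by
    rw [X_dvd_iff, coeff_zero_eq_eval_zero]; simp [ha]
  have h2 : (X : F[X]) ^ (p ^ r) ∣ (X + C a) ^ n - 1 := by
    have : (X + C a : F[X]) ^ n - 1 = ((X + C a) ^ m - 1) ^ (p ^ r) := by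
      rw [sub_pow_char_pow, hn, pow_mul, one_pow]
    rw [this]; exact pow_dvd_pow_of_dvd h1 _
  have h3 : (X : F[X]) ^ (p ^ r) ∣ (X + C a) ^ k - (X + C a) ^ (k % n) := by
    have e : (X + C a : F[X]) ^ k - (X + C a) ^ (k % n)
        = (X + C a) ^ (k % n) * (((X + C a) ^ n) ^ (k / n) - 1 ^ (k / n)) := by
      conv_lhs => rw [← Nat.mod_add_div k n]
      simp only [Nat.add_mul_mod_self_left, Nat.mod_mod, pow_add, pow_mul, one_pow]
      ring
    rw [e]
    exact Dvd.dvd.mul_left (h2.trans (sub_dvd_pow_sub_pow _ _ _)) _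
  have := (X_pow_dvd_iff.1 h3) d hd
  rw [coeff_sub, sub_eq_zero] at this
  exact this.symm

open Polynomial in
lemma cvm_mul_circulant {A F : Type*} [Fintype A] [DecidableEq A] [Field F] {p r m n : ℕ}
    [NeZero n]
    (hp : p.Prime) [CharP F p] (hn : n = m * p ^ r) (z : A → F) (hz : ∀ b, z b ^ m = 1)
    (w : Fin n → F) :
    cvm n (p ^ r) z * Matrix.circulant w = blk (tay (p ^ r) z w) * cvm n (p ^ r) z := by
  have hN : 0 < p ^ r := pow_pos hp.pos r
  ext ⟨b, d⟩ j
  have hL : (cvm n (p ^ r) z * Matrix.circulant w) (b, d) j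
      = (expandAt w (z b) * (X + C (z b)) ^ (j : ℕ)).coeff (p ^ r - 1 - (d : ℕ)) := by
    rw [Matrix.mul_apply, expandAt, Finset.sum_mul, finsetSum_coeff,
      ← Equiv.sum_comp (Equiv.addRight j)]
    refine Finset.sum_congr rfl fun k _ => ?_
    simp only [cvm, Matrix.of_apply, Matrix.circulant_apply, Equiv.coe_addRight,
      add_sub_cancel_right]
    rw [mul_assoc, coeff_C_mul, ← pow_add, mul_comm, Fin.val_add,
      pow_mod_coeff hp hn _ (hz b) _ _ (by omega)]
  rw [hL, coeff_mul, Finset.Nat.sum_antidiagonal_eq_sum_range_succ_mk, Matrix.mul_apply,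
    Fintype.sum_prod_type, Finset.sum_eq_single b]
  rotate_left
  · intro b' _ hb
    simp [blk, Ne.symm hb]
  · simp
  have hR : ∀ d' : Fin (p ^ r),
      blk (tay (p ^ r) z w) (b, d) (b, d') * cvm n (p ^ r) z (b, d') j
      = (fun e : ℕ => if (d : ℕ) ≤ e then (expandAt w (z b)).coeff (e - d) *
        ((X + C (z b)) ^ (j : ℕ)).coeff (p ^ r - 1 - e) else 0) (d' : ℕ) := by
    intro d'
    have h1 := d.2
    have h2 := d'.2
    simp only [blk, cvm, Matrix.of_apply, triangularOf, tay, if_true]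
    split_ifs with h
    · congr 2
      omega
    · simp
  rw [Finset.sum_congr rfl fun d' _ => hR d']
  refine Eq.trans ?_ (Fin.sum_univ_eq_sum_range (fun e : ℕ => if (d : ℕ) ≤ e then
    (expandAt w (z b)).coeff (e - d) *
      ((X + C (z b)) ^ (j : ℕ) : F[X]).coeff (p ^ r - 1 - e) else 0) (p ^ r)).symm
  have hd := d.2
  have e1 : p ^ r = d + (p ^ r - 1 - d).succ := by omega
  conv_rhs => rw [show Finset.range (p ^ r) = Finset.range (d + (p ^ r - 1 - d).succ) by rw [← e1]]
  rw [Finset.sum_range_add, Finset.sum_eq_zero (s := Finset.range (d : ℕ)), zero_add]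
  · refine Finset.sum_congr rfl fun k hk => ?_
    rw [if_pos (by omega)]
    congr 2 <;> omega
  · intro k hk
    rw [if_neg]
    simpa using hk

open Polynomial in
lemma tay_inj {A F : Type*} [Fintype A] [DecidableEq A] [Field F] {N n : ℕ}
    (hn : n = Fintype.card A * N) (z : A → F) (hz : Function.Injective z)
    (w : Fin n → F) (h : tay N z w = 0) : w = 0 := by
  set f : F[X] := ∑ i : Fin n, C (w i) * X ^ (i : ℕ) with hf
  have hcomp : ∀ a, f.comp (X + C a) = expandAt w a := by
    intro a
    simp [hf, expandAt]
  have hdvd : ∀ b, (X - C (z b)) ^ N ∣ f := by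
    intro b
    have h1 : (X : F[X]) ^ N ∣ f.comp (X + C (z b)) := by
      rw [hcomp, X_pow_dvd_iff]
      intro d hd
      have := congrFun (congrFun h b) ⟨N - 1 - d, by omega⟩
      simp only [tay, Pi.zero_apply] at this
      rwa [show N - 1 - (N - 1 - d) = d by omega] at this
    obtain ⟨g, hg⟩ := h1
    refine ⟨g.comp (X - C (z b)), ?_⟩
    have := congrArg (fun q => q.comp (X - C (z b))) hg
    simpa [Polynomial.comp_assoc] using this
  have hprod : (∏ b : A, (X - C (z b)) ^ N) ∣ f := by
    apply Finset.prod_dvd_of_coprime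
    · intro a _ b _ hab
      exact (pairwise_coprime_X_sub_C hz hab).pow
    · intro b _; exact hdvd b
  have hmon : (∏ b : A, (X - C (z b)) ^ N).Monic :=
    monic_prod_of_monic _ _ fun b _ => (monic_X_sub_C _).pow _
  have hdeg : (∏ b : A, (X - C (z b)) ^ N).natDegree = n := by
    rw [natDegree_prod_of_monic _ _ fun b _ => (monic_X_sub_C _).pow _]
    simp [hn]
  have hf0 : f = 0 := by
    by_contra hne
    have h1 := Polynomial.degree_le_of_dvd hprod hne
    rw [degree_eq_natDegree hmon.ne_zero, hdeg] at h1
    have h2 : f.degree < n := by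
      rw [hf]
      refine (degree_sum_le _ _).trans_lt ?_
      rw [Finset.sup_lt_iff (by exact WithBot.bot_lt_coe n)]
      intro i _
      exact (degree_C_mul_X_pow_le _ _).trans_lt (by exact_mod_cast i.2)
    exact absurd h1 (not_le.2 h2)
  funext i
  have := congrArg (fun q => q.coeff (i : ℕ)) hf0
  simpa [hf, finsetSum_coeff, coeff_C_mul, coeff_X_pow, Fin.val_inj] using this

open Polynomial in
lemma tay_frob {A F : Type*} [Field F] {N n p t : ℕ} [Fact p.Prime] [CharP F p]
    (z : A → F) (σ : A → A) (hσ : ∀ b, z (σ b) = z b ^ p ^ t)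
    (w : Fin n → F) (b : A) (j : Fin N) :
    tay N z (fun i => w i ^ p ^ t) (σ b) j = (tay N z w b j) ^ p ^ t := by
  have : expandAt (fun i => w i ^ p ^ t) (z (σ b))
      = (expandAt w (z b)).map (iterateFrobenius F p t) := by
    simp [expandAt, Polynomial.map_sum, iterateFrobenius_def, hσ]
  simp only [tay, this, coeff_map, iterateFrobenius_def]

lemma isUnit_blk {A F : Type*} [Fintype A] [DecidableEq A] [Field F] {N : ℕ} (hN : N - 1 < N)
    (v : A → Fin N → F) : IsUnit (blk v) ↔ ∀ b, v b ⟨N - 1, hN⟩ ≠ 0 := by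
  have e : blk v = Matrix.reindex (Equiv.prodComm _ _) (Equiv.prodComm _ _)
      (Matrix.blockDiagonal fun b => triangularOf (v b)) := by
    ext ⟨a, i⟩ ⟨b, j⟩
    simp [blk, Matrix.blockDiagonal_apply]
  have hd : ∀ b, (triangularOf (v b)).det = v b ⟨N - 1, hN⟩ ^ N := by
    intro b
    rw [Matrix.det_of_isUpperTriangular]
    · rw [Finset.prod_congr rfl (g := fun _ => v b ⟨N - 1, hN⟩)]
      · simp
      · intro i _
        have := i.2
        simp only [triangularOf, Matrix.of_apply, le_refl, dif_pos]
        congr 2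
        omega
    · intro i j hij
      simp only [triangularOf, Matrix.of_apply]
      rw [dif_neg]
      exact not_le.2 hij
  rw [Matrix.isUnit_iff_isUnit_det, e, Matrix.det_reindex_self, Matrix.det_blockDiagonal,
    isUnit_iff_ne_zero, Finset.prod_ne_zero_iff]
  simp [hd]
  have : N ≠ 0 := by omega
  simp [this]

lemma core {A F : Type*} [Fintype A] [DecidableEq A] [Field F] {n m p r t : ℕ} [NeZero n]
    (hp : p.Prime) [CharP F p] (hn : n = m * p ^ r) (hA : Fintype.card A = m)
    (z : A → F) (hz : Function.Injective z) (hzm : ∀ b, z b ^ m = 1)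
    (σ : A → A) (hσs : Function.Surjective σ) (hσ : ∀ b, z (σ b) = z b ^ p ^ t)
    (hN : p ^ r - 1 < p ^ r) :
    ∃ (e : Fin n ≃ A × Fin (p ^ r))
      (X : Matrix (A × Fin (p ^ r)) (A × Fin (p ^ r)) F),
      IsUnit X ∧
        ∀ B : Matrix (A × Fin (p ^ r)) (A × Fin (p ^ r)) F,
          (∃ M : Matrix (Fin n) (Fin n) F,
              (IsUnit M ∧ (∃ w, M = Matrix.circulant w) ∧
                ∀ i j, (M i j) ^ p ^ t = M i j) ∧
              B = X * (Matrix.reindex e e M) * X⁻¹) ↔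
          (∃ v : A → Fin (p ^ r) → F,
            B = blk v ∧ (∀ b, v b ⟨p ^ r - 1, hN⟩ ≠ 0) ∧
            ∀ b j, v (σ b) j = v b j ^ p ^ t) := by
  have := Fact.mk hp
  have hcard : Fintype.card (Fin n) = Fintype.card (A × Fin (p ^ r)) := by simp [hA, hn]
  let e : Fin n ≃ A × Fin (p ^ r) := Fintype.equivOfCardEq hcard
  let Y : Matrix (A × Fin (p ^ r)) (A × Fin (p ^ r)) F :=
    (cvm n (p ^ r) z).submatrix id e.symm
  have hYv : ∀ u, Y.mulVec u = fun x => tay (p ^ r) z (u ∘ e) x.1 x.2 := by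
    intro u
    funext x
    rw [← cvm_mulVec]
    simp only [Y, Matrix.mulVec, dotProduct, Matrix.submatrix_apply, id]
    rw [← e.sum_comp]
    simp
  have hY : IsUnit Y := by
    rw [← Matrix.mulVec_injective_iff_isUnit]
    intro u u' h
    have h0 : Y.mulVec (u - u') = 0 := by rw [Matrix.mulVec_sub, sub_eq_zero]; exact h
    rw [hYv] at h0
    have h1 := tay_inj (N := p ^ r) (by rw [hA, hn]) z hz ((u - u') ∘ e) (by
      funext b i; exact congrFun h0 (b, i))
    funext x
    have := congrFun h1 (e.symm x)
    simpa [sub_eq_zero] using this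
  have hYu : IsUnit Y.det := (Matrix.isUnit_iff_isUnit_det _).1 hY
  have hconj : ∀ w, Y * Matrix.reindex e e (Matrix.circulant w) * Y⁻¹
      = blk (tay (p ^ r) z w) := by
    intro w
    have h := cvm_mul_circulant hp hn z hzm w
    have : Y * Matrix.reindex e e (Matrix.circulant w) = blk (tay (p ^ r) z w) * Y := by
      have h2 := congrArg (fun Q => Q.submatrix id e.symm) h
      rw [← Matrix.submatrix_mul_equiv _ _ _ e.symm] at h2
      rw [Matrix.reindex_apply, h2]
      rfl
    rw [this, Matrix.mul_assoc, Matrix.mul_nonsing_inv _ hYu, Matrix.mul_one]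
  have hunit : ∀ w : Fin n → F, IsUnit (Matrix.circulant w) ↔ IsUnit (blk (tay (p ^ r) z w)) := by
    intro w
    rw [← hconj, Matrix.isUnit_iff_isUnit_det, Matrix.isUnit_iff_isUnit_det,
      Matrix.det_conj hY, Matrix.det_reindex_self]
  refine ⟨e, Y, hY, fun B => ⟨?_, ?_⟩⟩
  · rintro ⟨M, ⟨hM, ⟨w, rfl⟩, hfix⟩, rfl⟩
    refine ⟨tay (p ^ r) z w, hconj w, (isUnit_blk hN _).1 ((hunit w).1 hM), fun b j => ?_⟩
    rw [← tay_frob z σ hσ]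
    congr
    funext i
    have := hfix i 0
    simpa using this.symm
  · rintro ⟨v, rfl, hv, hfr⟩
    obtain ⟨u, hu⟩ := (Matrix.mulVec_surjective_iff_isUnit.2 hY) (fun x => v x.1 x.2)
    rw [hYv] at hu
    set w := u ∘ e with hw
    have hvw : tay (p ^ r) z w = v := by
      funext b i; exact congrFun hu (b, i)
    have hww : (fun i => w i ^ p ^ t) = w := by
      have : (fun i => w i ^ p ^ t) - w = 0 := by
        apply tay_inj (N := p ^ r) (by rw [hA, hn]) z hz
        have hlin : ∀ a b : Fin n → F, tay (p ^ r) z (a - b) = tay (p ^ r) z a - tay (p ^ r) z b := by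
          intro a b
          funext x y
          simp [tay, expandAt, sub_mul, Finset.sum_sub_distrib]
        rw [hlin, sub_eq_zero]
        funext b j
        obtain ⟨b, rfl⟩ := hσs b
        rw [tay_frob z σ hσ, hvw, hfr]
      exact sub_eq_zero.1 this
    subst hvw
    refine ⟨Matrix.circulant w, ⟨(hunit w).2 ((isUnit_blk hN _).2 hv), ⟨w, rfl⟩, ?_⟩, (hconj w).symm⟩
    intro i j
    exact congrFun hww (i - j)

lemma exists_labels {p t m : ℕ} [NeZero m] (hpm : p.Coprime m) {F : Type*} [Field F]
    (ζ : F) (hζ : IsPrimitiveRoot ζ m)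
    (l : ℕ) (mk : Fin l → ℕ) (hmk : ∀ k, 0 < mk k)
    (c : (k : Fin l) → Fin (mk k) → ZMod m)
    (hdisj : Function.Bijective fun x : Σ k : Fin l, Fin (mk k) => c x.1 x.2)
    (hcyc : ∀ (k : Fin l) (i : Fin (mk k)),
      ((p : ZMod m) ^ t)⁻¹ * c k i = c k ⟨((i : ℕ) + 1) % mk k, Nat.mod_lt _ (hmk k)⟩) :
    ∃ z : ZMod m → F, Function.Injective z ∧ (∀ b, z b ^ m = 1) ∧
      ∀ b, z (((p : ZMod m) ^ t)⁻¹ * b) = z b ^ p ^ t := by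
  have hu : (p : ZMod m) ^ t * ((p : ZMod m) ^ t)⁻¹ = 1 := by
    have := ZMod.coe_mul_inv_eq_one (n := m) (p ^ t) (Nat.Coprime.pow_left t hpm)
    simpa using this
  let E := Equiv.ofBijective _ hdisj
  let ρ : (Σ k : Fin l, Fin (mk k)) → (Σ k : Fin l, Fin (mk k)) :=
    fun x => ⟨x.1, ⟨(mk x.1 - x.2) % mk x.1, Nat.mod_lt _ (hmk x.1)⟩⟩
  have hρ : ∀ x, ρ (ρ x) = x := by
    rintro ⟨k, i, hi⟩
    simp only [ρ]
    congr 2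
    rcases Nat.eq_zero_or_pos i with h | h
    · subst h; simp
    · rw [Nat.mod_eq_of_lt (a := mk k - i) (by omega), Nat.mod_eq_of_lt (by omega)]; omega
  have hρi : Function.Injective ρ := Function.LeftInverse.injective hρ
  refine ⟨fun b => ζ ^ (E (ρ (E.symm b))).val, ?_, ?_, ?_⟩
  · intro a b h
    have := hζ.pow_inj (ZMod.val_lt _) (ZMod.val_lt _) h
    exact E.symm.injective (hρi (E.injective (ZMod.val_injective m this)))
  · intro b
    rw [← pow_mul, mul_comm, pow_mul, hζ.pow_eq_one, one_pow]
  · intro b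
    obtain ⟨⟨k, i⟩, rfl⟩ := E.surjective b
    have h1 : ((p : ZMod m) ^ t)⁻¹ * E ⟨k, i⟩
        = E ⟨k, ⟨((i : ℕ) + 1) % mk k, Nat.mod_lt _ (hmk k)⟩⟩ := hcyc k i
    rw [h1]
    simp only [Equiv.symm_apply_apply]
    have h2 : E (ρ ⟨k, ⟨((i : ℕ) + 1) % mk k, Nat.mod_lt _ (hmk k)⟩⟩)
        = (p : ZMod m) ^ t * E (ρ ⟨k, i⟩) := by
      have h3 := hcyc k (ρ ⟨k, ⟨((i : ℕ) + 1) % mk k, Nat.mod_lt _ (hmk k)⟩⟩).2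
      have h4 : (⟨((ρ ⟨k, ⟨((i : ℕ) + 1) % mk k, Nat.mod_lt _ (hmk k)⟩⟩).2 + 1) % mk k,
          Nat.mod_lt _ (hmk k)⟩ : Fin (mk k)) = (ρ ⟨k, i⟩).2 := by
        simp only [ρ]
        congr 1
        have hi := i.2
        rcases Nat.lt_or_ge ((i : ℕ) + 1) (mk k) with h | h
        · rw [Nat.mod_eq_of_lt h, Nat.mod_add_mod]
          congr 1
          omega
        · have : (i : ℕ) + 1 = mk k := by omega
          rw [this, Nat.mod_self, Nat.sub_zero, Nat.mod_self]
          congr 1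
          omega
      change _ = c k _ at h3
      rw [h4] at h3
      change _ = (p : ZMod m) ^ t * c k (ρ ⟨k, i⟩).2
      rw [← h3, ← mul_assoc, hu, one_mul]
      rfl
    rw [h2, ← pow_mul]
    apply pow_eq_pow_of_modEq _ hζ.pow_eq_one
    rw [← ZMod.natCast_eq_natCast_iff]
    simp [mul_comm]

lemma cond_iff {A F : Type*} [Field F] {p t N : ℕ} {l : ℕ} (mk : Fin l → ℕ)
    (hmk : ∀ k, 0 < mk k) (c : (k : Fin l) → Fin (mk k) → A)
    (hsurj : ∀ b, ∃ k i, c k i = b) (σ : A → A)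
    (hcyc : ∀ (k : Fin l) (i : Fin (mk k)),
      σ (c k i) = c k ⟨((i : ℕ) + 1) % mk k, Nat.mod_lt _ (hmk k)⟩) (v : A → Fin N → F) :
    (∀ b j, v (σ b) j = v b j ^ p ^ t) ↔
      ((∀ k : Fin l, ∀ j : Fin N,
        (v (c k ⟨0, hmk k⟩) j) ^ p ^ (t * mk k) = v (c k ⟨0, hmk k⟩) j) ∧
      (∀ (k : Fin l) (i : Fin (mk k)) (j : Fin N),
        v (c k i) j = (v (c k ⟨0, hmk k⟩) j) ^ p ^ ((i : ℕ) * t))) := by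
  constructor
  · intro h
    have key : ∀ (k : Fin l) (j : Fin N) (i : ℕ),
        v (c k ⟨i % mk k, Nat.mod_lt _ (hmk k)⟩) j = (v (c k ⟨0, hmk k⟩) j) ^ p ^ (i * t) := by
      intro k j i
      induction i with
      | zero => simp
      | succ i ih =>
        have h1 := hcyc k ⟨i % mk k, Nat.mod_lt _ (hmk k)⟩
        simp only [Nat.mod_add_mod] at h1
        rw [← h1, h, ih, ← pow_mul, ← pow_add]
        congr 2
        ring
    refine ⟨fun k j => ?_, fun k i j => ?_⟩
    · have := key k j (mk k)
      simp only [Nat.mod_self] at this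
      rw [mul_comm]
      exact this.symm
    · have := key k j i
      simp only [Nat.mod_eq_of_lt i.2] at this
      exact this
  · rintro ⟨hb, hc⟩ b j
    obtain ⟨k, i, rfl⟩ := hsurj b
    rw [hcyc, hc, hc k i, ← pow_mul, ← pow_add]
    have hi := i.2
    rcases Nat.lt_or_ge ((i : ℕ) + 1) (mk k) with h | h
    · simp only [Nat.mod_eq_of_lt h]
      congr 2
      ring
    · have : (i : ℕ) + 1 = mk k := by omega
      simp only [this, Nat.mod_self, zero_mul, pow_zero, pow_one]
      have e : (i : ℕ) * t + t = t * mk k := by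
        calc (i : ℕ) * t + t = t * ((i : ℕ) + 1) := by ring
          _ = t * mk k := congrArg _ this
      rw [e, hb]

/-- **Theorem 1(ii)**: Let `p` be a prime, `n = m·p^r` with `p ∤ m`, and let `F` be the field
with `p^s` elements, where `t ∣ s` and `F` contains the `m`-th roots of unity (`m ∣ p^s − 1`);
the subfield `𝔽_{p^t}` is the fixed field of the relative Frobenius `F^t : x ↦ x^{p^t}`.
Let `σ : ℤ/mℤ → ℤ/mℤ, x ↦ p^{−t}·x`, decomposed into disjoint cycles
`σ_k = (s_{k,1}, …, s_{k,m_k})` (`k = 1, …, l`, covering all of `ℤ/mℤ`). Then, inside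
`GL_n(F)`, the group `RC_n(𝔽_{p^t})` of invertible circulant matrices with entries in
`𝔽_{p^t}` is conjugate (after identifying the index set `Fin n` with `ℤ/mℤ × Fin (p^r)`)
to the group of block-diagonal matrices `diag(T(v_{(1)}), …, T(v_{(m)}))` whose block
vectors `v_{(i)} ∈ F^{p^r}` satisfy: (a) the last coordinate of each `v_{(i)}` is nonzero;
(b) `v_{(s_{k,1})}` has entries in `𝔽_{p^{t·m_k}}`; (c) `v_{(s_{k,i})} = F^{(i−1)t}(v_{(s_{k,1})})`. -/
theorem regular_circulant_conjugate_to_block_triangular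
    (p t s n m r : ℕ) (hp : p.Prime) [NeZero n] [NeZero m]
    (ht : t ≠ 0) (hs : s ≠ 0) (hts : t ∣ s)
    (hn : n = m * p ^ r) (hpm : ¬ p ∣ m) (hroots : m ∣ p ^ s - 1)
    (F : Type*) [Field F] [Fintype F] [DecidableEq F] (hF : Fintype.card F = p ^ s)
    (l : ℕ) (mk : Fin l → ℕ) (hmk : ∀ k, 0 < mk k)
    (c : (k : Fin l) → Fin (mk k) → ZMod m)
    (hdisj : Function.Bijective fun x : Σ k : Fin l, Fin (mk k) => c x.1 x.2)
    (hcyc : ∀ (k : Fin l) (i : Fin (mk k)),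
      ((p : ZMod m) ^ t)⁻¹ * c k i = c k ⟨((i : ℕ) + 1) % mk k, Nat.mod_lt _ (hmk k)⟩) :
    ∃ (e : Fin n ≃ ZMod m × Fin (p ^ r))
      (X : Matrix (ZMod m × Fin (p ^ r)) (ZMod m × Fin (p ^ r)) F),
      IsUnit X ∧
        ∀ B : Matrix (ZMod m × Fin (p ^ r)) (ZMod m × Fin (p ^ r)) F,
          (∃ M : Matrix (Fin n) (Fin n) F,
              (IsUnit M ∧ (∃ w, M = Matrix.circulant w) ∧
                ∀ i j, (M i j) ^ p ^ t = M i j) ∧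
              B = X * (Matrix.reindex e e M) * X⁻¹) ↔
          (∃ v : ZMod m → Fin (p ^ r) → F,
            (B = Matrix.of fun x y : ZMod m × Fin (p ^ r) =>
              if x.1 = y.1 then triangularOf (v x.1) x.2 y.2 else 0) ∧
            (∀ b : ZMod m,
              v b ⟨p ^ r - 1, Nat.sub_lt (pow_pos hp.pos r) Nat.one_pos⟩ ≠ 0) ∧
            (∀ k : Fin l, ∀ j : Fin (p ^ r),
              (v (c k ⟨0, hmk k⟩) j) ^ p ^ (t * mk k) = v (c k ⟨0, hmk k⟩) j) ∧
            (∀ (k : Fin l) (i : Fin (mk k)) (j : Fin (p ^ r)),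
              v (c k i) j = (v (c k ⟨0, hmk k⟩) j) ^ p ^ ((i : ℕ) * t))) := by
  have := Fact.mk hp
  have hchar : CharP F p := charP_of_card_eq_prime_pow hF
  have hcop : p.Coprime m := (Nat.Prime.coprime_iff_not_dvd hp).2 hpm
  obtain ⟨ζ, hζ⟩ : ∃ ζ : F, IsPrimitiveRoot ζ m := by
    obtain ⟨g, hg⟩ := IsCyclic.exists_generator (α := Fˣ)
    have ho : orderOf g = p ^ s - 1 := by
      rw [orderOf_eq_card_of_forall_mem_zpowers hg, Nat.card_eq_fintype_card, Fintype.card_units, hF]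
    have hpos : 0 < p ^ s - 1 := by
      have := Nat.one_lt_pow hs hp.one_lt
      omega
    obtain ⟨a, ha⟩ := hroots
    have hg1 : IsPrimitiveRoot g (p ^ s - 1) := ho ▸ IsPrimitiveRoot.orderOf g
    have := hg1.pow hpos (show p ^ s - 1 = a * m by rw [ha, mul_comm])
    exact ⟨_, this.map_of_injective (f := Units.coeHom F) Units.val_injective⟩
  obtain ⟨z, hz, hzm, hσ⟩ := exists_labels hcop ζ hζ l mk hmk c hdisj hcyc
  have hu : (p : ZMod m) ^ t * ((p : ZMod m) ^ t)⁻¹ = 1 := by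
    have := ZMod.coe_mul_inv_eq_one (n := m) (p ^ t) (Nat.Coprime.pow_left t hcop)
    simpa using this
  obtain ⟨e, Y, hY, h⟩ := core hp hn (ZMod.card m) z hz hzm (fun b => ((p : ZMod m) ^ t)⁻¹ * b)
    (fun b => ⟨(p : ZMod m) ^ t * b, by
      simp only; rw [← mul_assoc, mul_comm _ ((p : ZMod m) ^ t), hu, one_mul]⟩) hσ
    (Nat.sub_lt (pow_pos hp.pos r) Nat.one_pos)
  refine ⟨e, Y, hY, fun B => (h B).trans ?_⟩
  refine exists_congr fun v => and_congr Iff.rfl (and_congr Iff.rfl ?_)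
  exact cond_iff mk hmk c (fun b => by
    obtain ⟨⟨k, i⟩, h⟩ := hdisj.2 b
    exact ⟨k, i, h⟩) _ hcyc v
end
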